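/- (Kostant) Let Φ be a finite reduced crystallographic root system with base Δ of cardinality n and positive roots Φ⁺, and let ρ = (1/2) Σ_{γ∈Φ⁺} γ be the half-sum of the positive roots, so that ⟨ρ, α^∨⟩ equals the height of the coroot α^∨ (the sum of its coefficients in the simple coroots). Then there exist integers a_1, …, a_n with a_i ≥ 2 for all i, such that the following equality of multisets of integers holds: {⟨ρ, α^∨⟩ + 1 : α ∈ Φ⁺} = {⟨ρ, α^∨⟩ : α ∈ Φ⁺ \ Δ} + {a_1, …, a_n}, where on the left the values ⟨ρ, α^∨⟩ + 1 are counted with multiplicity over all positive roots α, and on the right the values ⟨ρ, α^∨⟩ are counted with multiplicity over all positive non-simple roots α. -/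

import Mathlib

namespace KostantAux
open RootPairing RootPairing.GeckConstruction Module Matrix
attribute [local instance] LieRing.ofAssociativeRing

theorem irred_case {ι K M N : Type*} [Fintype ι] [Field K] [CharZero K]
    [AddCommGroup M] [Module K M] [AddCommGroup N] [Module K N]
    (P : RootPairing ι K M N) [P.IsCrystallographic] [P.IsReduced] [P.IsIrreducible]
    [P.IsRootSystem] (b : P.Base) (g : M →ₗ[K] K) (hg : ∀ i ∈ b.support, g (P.root i) = 1)
    (k : ℕ) (hk : 1 ≤ k) :
    Nat.card {i // g (P.root i) = (k : K) + 1} ≤ Nat.card {i // g (P.root i) = (k : K)} := by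
  classical
  rcases isEmpty_or_nonempty ι with hι | hι
  · simp
  -- coefficients of the functional in the simple coroots
  obtain ⟨c, hc⟩ : ∃ c : b.support → K, ∀ i, ∑ j, c j * P.pairing i j = 2 * g (P.root i) := by
    let n : N := P.flip.toPerfPair.symm ((2 : K) • g)
    have hn : ∀ x, P.toLinearMap x n = 2 * g x := by
      intro x
      have : P.flip.toPerfPair n = (2 : K) • g := by simp [n]
      have := LinearMap.congr_fun this x
      simpa using this
    refine ⟨fun j => b.toCoweightBasis.repr n j, fun i => ?_⟩
    rw [← hn]
    conv_rhs => rw [← b.toCoweightBasis.sum_repr n]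
    simp
  have hcA : ∀ i : b.support, ∑ j, c j * (b.cartanMatrix i j : K) = 2 := by
    intro i
    have := hc i
    rw [hg i i.2, mul_one] at this
    rw [← this]
    refine Finset.sum_congr rfl fun j _ => ?_
    rw [Base.cartanMatrix, Base.cartanMatrixIn_def, ← P.algebraMap_pairingIn ℤ]
    simp
  let H : Matrix (b.support ⊕ ι) (b.support ⊕ ι) K := ∑ j, c j • h j
  let E : Matrix (b.support ⊕ ι) (b.support ⊕ ι) K := ∑ j, e j
  let F : Matrix (b.support ⊕ ι) (b.support ⊕ ι) K := ∑ j, c j • f j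
  have hH : H = Matrix.diagonal (Sum.elim 0 (fun i => 2 * g (P.root i))) := by
    simp only [H, h_eq_diagonal]
    ext (x | x) (y | y)
    · simp [Matrix.sum_apply, Matrix.diagonal_apply]
    · simp [Matrix.sum_apply, Matrix.diagonal_apply]
    · simp [Matrix.sum_apply, Matrix.diagonal_apply]
    · by_cases hxy : x = y
      · subst hxy
        simp only [Matrix.sum_apply, Matrix.smul_apply, Matrix.diagonal_apply_eq, Sum.elim_inr,
          smul_eq_mul, ← hc x]
        refine Finset.sum_congr rfl fun j _ => ?_
        rw [← P.algebraMap_pairingIn ℤ]; simp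
      · simp [Matrix.sum_apply, Matrix.diagonal_apply, hxy]
  have hEF : ⁅E, F⁆ = H := by
    simp only [E, F, H, LieRing.of_associative_ring_bracket, Finset.sum_mul_sum]
    rw [Finset.sum_comm (s := Finset.univ) (t := Finset.univ) (f := fun i j => c i • f i * e j),
      ← Finset.sum_sub_distrib]
    refine Finset.sum_congr rfl fun i _ => ?_
    rw [← Finset.sum_sub_distrib, Finset.sum_eq_single i]
    · rw [mul_smul_comm, smul_mul_assoc, ← smul_sub, ← lie_e_f_same, Ring.lie_def]
    · intro j _ hj
      rw [mul_smul_comm, smul_mul_assoc, ← smul_sub, ← Ring.lie_def, lie_e_f_ne hj.symm, smul_zero]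
    · simp
  have hHE : ⁅H, E⁆ = 2 • E := by
    simp only [E, H, LieRing.of_associative_ring_bracket, Finset.sum_mul_sum]
    rw [Finset.sum_comm, ← Finset.sum_sub_distrib, Finset.smul_sum]
    refine Finset.sum_congr rfl fun i _ => ?_
    rw [← Finset.sum_sub_distrib]
    have : ∀ j ∈ Finset.univ, c j • h j * e i - e i * c j • h j
        = (c j * (b.cartanMatrix i j : K)) • (e i : Matrix (b.support ⊕ ι) _ K) := by
      intro j _
      rw [mul_smul_comm, smul_mul_assoc, ← smul_sub, ← Ring.lie_def, lie_h_e, mul_smul,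
        Int.cast_smul_eq_zsmul]
    rw [Finset.sum_congr rfl this, ← Finset.sum_smul, hcA, two_smul, two_nsmul]
  have hHF : ⁅H, F⁆ = -(2 • F) := by
    simp only [F, H, LieRing.of_associative_ring_bracket, Finset.sum_mul_sum]
    rw [Finset.sum_comm, ← Finset.sum_sub_distrib, Finset.smul_sum, ← Finset.sum_neg_distrib]
    refine Finset.sum_congr rfl fun i _ => ?_
    rw [← Finset.sum_sub_distrib]
    have : ∀ j ∈ Finset.univ, c j • h j * c i • f i - c i • f i * c j • h j
        = (c j * (b.cartanMatrix i j : K)) • (-(c i • f i) : Matrix (b.support ⊕ ι) _ K) := by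
      intro j _
      have := lie_h_f (P := P) (b := b) i j
      rw [Ring.lie_def, sub_eq_iff_eq_add] at this
      simp only [mul_smul_comm, smul_mul_assoc, this, smul_add, smul_smul,
        ← Int.cast_smul_eq_zsmul K]
      push_cast
      module
    rw [Finset.sum_congr rfl this, ← Finset.sum_smul, hcA, two_smul, two_nsmul]
    abel
  have ht : IsSl2Triple H E F := by
    refine ⟨?_, hEF, hHE, hHF⟩
    obtain ⟨i, hi⟩ := b.support_nonempty
    intro h0
    have := congr_fun₂ (hH.symm.trans h0) (Sum.inr i) (Sum.inr i)
    simp [hg i hi] at this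
  -- injectivity
  have hinj : ∀ v : b.support ⊕ ι → K, ⁅H, v⁆ = (2 * ((k : K) + 1)) • v → ⁅F, v⁆ = 0 → v = 0 := by
    intro v hv hF
    by_contra hne
    have hp : ht.symm.HasPrimitiveVectorWith v (-(2 * ((k : K) + 1))) :=
      ⟨hne, by rw [neg_lie, hv, neg_smul], hF⟩
    obtain ⟨n, hn⟩ := hp.exists_nat
    have : ((n + 2 * (k + 1) : ℕ) : K) = 0 := by push_cast; rw [← hn]; ring
    have := Nat.cast_eq_zero.mp this
    omega
  have hHv : ∀ (v : b.support ⊕ ι → K) (x), ⁅H, v⁆ x =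
      Sum.elim (0 : b.support → K) (fun i => 2 * g (P.root i)) x * v x := by
    intro v x
    rw [hH]
    simp [Matrix.mulVec_diagonal]
  let ext : ({i // g (P.root i) = (k : K) + 1} → K) →ₗ[K] (b.support ⊕ ι → K) :=
    { toFun := fun y x => Sum.elim (fun _ => 0) (fun i => if hi : g (P.root i) = (k : K) + 1 then y ⟨i, hi⟩ else 0) x
      map_add' := by
        intro y z; ext (x | x)
        · simp
        · by_cases hi : g (P.root x) = (k : K) + 1 <;> simp [hi]
      map_smul' := by
        intro a y; ext (x | x)
        · simp
        · by_cases hi : g (P.root x) = (k : K) + 1 <;> simp [hi] }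
  let res : (b.support ⊕ ι → K) →ₗ[K] ({i // g (P.root i) = (k : K)} → K) :=
    LinearMap.funLeft K K (fun i => Sum.inr i.1)
  let T := res ∘ₗ (Matrix.mulVecLin F) ∘ₗ ext
  have hT : Function.Injective T := by
    rw [← LinearMap.ker_eq_bot, LinearMap.ker_eq_bot']
    intro y hy
    have hw : ⁅H, ext y⁆ = (2 * ((k : K) + 1)) • ext y := by
      funext x
      rw [hHv]
      rcases x with x | x
      · simp [ext]
      · by_cases hi : g (P.root x) = (k : K) + 1 <;> simp [ext, hi]
    have hFw : ⁅H, ⁅F, ext y⁆⁆ = (2 * (k : K)) • ⁅F, ext y⁆ := by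
      rw [leibniz_lie, hHF, hw, neg_lie, lie_smul, two_nsmul, add_lie]
      module
    have hF0 : ⁅F, ext y⁆ = 0 := by
      funext x
      have h1 := congr_fun hFw x
      rw [hHv] at h1
      have hk0 : (k : K) ≠ 0 := by exact_mod_cast (by omega : k ≠ 0)
      rcases x with x | x
      · simpa [hk0] using h1
      · by_cases hi : g (P.root x) = (k : K)
        · exact congr_fun hy ⟨x, hi⟩
        · simp only [Sum.elim_inr, Pi.smul_apply, smul_eq_mul] at h1
          have h2 : (g (P.root x) - k) * ⁅F, ext y⁆ (Sum.inr x) = 0 := by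
            have h2 : (2 : K) ≠ 0 := two_ne_zero
            apply mul_left_cancel₀ h2
            linear_combination h1
          simpa [sub_eq_zero, hi] using h2
    have h0 := hinj _ hw hF0
    funext i
    have := congr_fun h0 (Sum.inr i.1)
    simpa [ext, i.2] using this
  have := LinearMap.finrank_le_finrank_of_injective hT
  simpa [Nat.card_eq_fintype_card] using this
end KostantAux

namespace KostantAux
open RootPairing Module

theorem exists_sub {ι K M N : Type*} [Finite ι] [Field K] [CharZero K]
    [AddCommGroup M] [Module K M] [AddCommGroup N] [Module K N] [FiniteDimensional K M]
    (P : RootPairing ι K M N) [P.IsCrystallographic] [P.IsReduced] [P.IsRootSystem]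
    (q : P.invtRootSubmodule) :
    ∃ Q : RootPairing {i // P.root i ∈ (q : Submodule K M)} K (q : Submodule K M)
        (Dual K (q : Submodule K M)),
      (∀ i, (Q.root i : M) = P.root i) ∧ Q.IsRootSystem ∧ Q.IsCrystallographic ∧ Q.IsReduced := by
  classical
  let J := {i // P.root i ∈ (q : Submodule K M)}
  let rt : J ↪ (q : Submodule K M) :=
    ⟨fun i => ⟨P.root i, i.2⟩, fun i j h => by
      have := congrArg Subtype.val h
      exact Subtype.ext (P.root.injective this)⟩
  let crt : J ↪ Dual K (q : Submodule K M) :=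
    ⟨fun i => (P.coroot' i).domRestrict _, fun i j h => by
      apply Subtype.ext
      apply P.coroot.injective
      apply P.flip.toPerfPair.injective
      have hh : ∀ k, P.root k ∈ LinearMap.ker (P.coroot' i - P.coroot' j) := by
        intro k
        rw [LinearMap.mem_ker, LinearMap.sub_apply]
        by_cases hk : P.root k ∈ (q : Submodule K M)
        · have := LinearMap.congr_fun h ⟨P.root k, hk⟩
          simpa [sub_eq_zero] using this
        · have h1 : ∀ l : J, P.coroot' l (P.root k) = 0 := by
            intro l
            rw [P.root_coroot'_eq_pairing, P.pairing_eq_zero_iff', ← P.root_coroot'_eq_pairing]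
            exact LinearMap.mem_ker.mp (invtRootSubmodule.le_ker_coroot' q hk l.2)
          rw [h1, h1, sub_zero]
      have h2 : (⊤ : Submodule K M) ≤ LinearMap.ker (P.coroot' i - P.coroot' j) := by
        rw [← IsRootSystem.span_root_eq_top (P := P), Submodule.span_le]
        rintro _ ⟨k, rfl⟩
        exact hh k
      ext x
      have := h2 (Submodule.mem_top (x := x))
      rw [LinearMap.mem_ker, LinearMap.sub_apply, sub_eq_zero] at this
      simpa using this⟩
  have hrt : ∀ i, (rt i : M) = P.root i := fun i => rfl
  have hcrt : ∀ i x, crt i x = P.coroot' i x := fun i x => rfl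
  have hrefl : ∀ i j : J, P.root (P.reflectionPerm i j) ∈ (q : Submodule K M) := by
    intro i j
    rw [P.root_reflectionPerm]
    exact P.mem_invtRootSubmodule_iff.mp q.2 i j.2
  have hpair : ∀ i j : J, Dual.eval K (q : Submodule K M) (rt i) (crt j) = P.pairing i j := by
    intro i j
    rw [Dual.eval_apply, hcrt, hrt, P.root_coroot'_eq_pairing]
  let Q := RootPairing.mk'' (Dual.eval K (q : Submodule K M)) rt crt
    (fun i => by rw [hpair]; simp)
    (by
      rintro i _ ⟨j, rfl⟩
      refine ⟨⟨P.reflectionPerm i j, hrefl i j⟩, ?_⟩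
      apply Subtype.ext
      rw [hrt, Module.preReflection_apply, LinearMap.flip_apply, Dual.eval_apply, hcrt,
        Submodule.coe_sub, Submodule.coe_smul, hrt, hrt, P.root_reflectionPerm,
        P.reflection_apply])
    (by
      apply Submodule.map_injective_of_injective (q : Submodule K M).injective_subtype
      rw [Submodule.map_span, Submodule.map_top, Submodule.range_subtype]
      conv_rhs => rw [invtRootSubmodule.eq_span_root q]
      congr 1
      ext x
      simp only [Set.mem_image, Set.mem_range, Set.mem_ofPred_eq, exists_exists_eq_and,
        Submodule.subtype_apply, hrt]
      constructor
      · rintro ⟨i, hi⟩; exact ⟨i, i.2, hi⟩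
      · rintro ⟨i, hi, h⟩; exact ⟨⟨i, hi⟩, h⟩)
  have hQp : ∀ i j, Q.pairing i j = P.pairing i j := hpair
  have hQr : ∀ i, (Q.root i : M) = P.root i := fun i => rfl
  refine ⟨Q, hQr, ?_, ?_, ?_⟩
  · apply isRootSystem_mk''
    intro i j
    refine ⟨P.pairingIn ℤ i j, ?_⟩
    rw [hpair, ← P.algebraMap_pairingIn ℤ]; simp
  · refine ⟨fun i j => ⟨P.pairingIn ℤ i j, ?_⟩⟩
    rw [hQp, P.algebraMap_pairingIn]
  · refine ⟨fun i j hl => ?_⟩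
    have := IsReduced.eq_or_eq_neg (P := P) i.1 j.1 (by
      intro h
      apply hl
      have h3 : LinearIndependent K ((q : Submodule K M).subtype ∘ ![Q.root i, Q.root j]) := by
        have h4 : (q : Submodule K M).subtype ∘ ![Q.root i, Q.root j] =
            ![P.root i, P.root j] := by
          ext x; fin_cases x <;> simp [hQr]
        rw [h4]; exact h
      exact h3.of_comp)
    rcases this with h | h
    · left; apply Subtype.ext; rw [hQr, hQr, h]
    · right; apply Subtype.ext; rw [Submodule.coe_neg, hQr, hQr, h]

/-- The simple roots inside an invariant subspace form a base of it. -/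
theorem closure_sub {ι K M N : Type*} [Finite ι] [Field K] [CharZero K]
    [AddCommGroup M] [Module K M] [AddCommGroup N] [Module K N]
    (P : RootPairing ι K M N) [P.IsRootSystem]
    (q : P.invtRootSubmodule) (s : Set ι) (x : M) (hxq : x ∈ (q : Submodule K M))
    (hx : x ∈ AddSubmonoid.closure (P.root '' s)) :
    x ∈ AddSubmonoid.closure (P.root '' (s ∩ {i | P.root i ∈ (q : Submodule K M)})) := by
  have hs : s = (s ∩ {i | P.root i ∈ (q : Submodule K M)}) ∪
      (s ∩ {i | P.root i ∉ (q : Submodule K M)}) := by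
    ext i; by_cases h : P.root i ∈ (q : Submodule K M) <;> simp [h]
  rw [hs, Set.image_union, AddSubmonoid.closure_union, AddSubmonoid.mem_sup] at hx
  obtain ⟨a, ha, c, hc, rfl⟩ := hx
  have haq : a ∈ (q : Submodule K M) := by
    have : AddSubmonoid.closure (P.root '' (s ∩ {i | P.root i ∈ (q : Submodule K M)}))
        ≤ (q : Submodule K M).toAddSubmonoid := by
      rw [AddSubmonoid.closure_le]
      rintro _ ⟨i, hi, rfl⟩
      exact hi.2
    exact this ha
  have hcq : c ∈ (q : Submodule K M) := by
    simpa using (q : Submodule K M).sub_mem hxq haq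
  have hc0 : c = 0 := by
    rw [P.eq_zero_iff_forall_coroot'_eq_zero]
    intro k
    by_cases hk : P.root k ∈ (q : Submodule K M)
    · have : AddSubmonoid.closure (P.root '' (s ∩ {i | P.root i ∉ (q : Submodule K M)}))
          ≤ (LinearMap.ker (P.coroot' k)).toAddSubmonoid := by
        rw [AddSubmonoid.closure_le]
        rintro _ ⟨i, hi, rfl⟩
        change P.coroot' k (P.root i) = 0
        rw [P.root_coroot'_eq_pairing, P.pairing_eq_zero_iff', ← P.root_coroot'_eq_pairing]
        exact LinearMap.mem_ker.mp (invtRootSubmodule.le_ker_coroot' q hi.2 hk)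
      exact this hc
    · exact LinearMap.mem_ker.mp (invtRootSubmodule.le_ker_coroot' q hk hcq)
  simpa [hc0] using ha

/-- The statement for a given root pairing. -/
def Good {ι K M N : Type*} [Field K]
    [AddCommGroup M] [Module K M] [AddCommGroup N] [Module K N]
    (P : RootPairing ι K M N) : Prop :=
  ∀ (s : Set ι), LinearIndepOn K P.root s →
    (∀ i, P.root i ∈ AddSubmonoid.closure (P.root '' s) ∨
      -P.root i ∈ AddSubmonoid.closure (P.root '' s)) →
    ∀ (g : M →ₗ[K] K), (∀ i ∈ s, g (P.root i) = 1) → ∀ k : ℕ, 1 ≤ k →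
    Nat.card {i // g (P.root i) = (k : K) + 1} ≤ Nat.card {i // g (P.root i) = (k : K)}

/-- Restriction of the statement to an invariant subspace. -/
theorem good_sub {ι K M N : Type*} [Finite ι] [Field K] [CharZero K]
    [AddCommGroup M] [Module K M] [AddCommGroup N] [Module K N]
    (P : RootPairing ι K M N) [P.IsRootSystem]
    (q : P.invtRootSubmodule)
    (Q : RootPairing {i // P.root i ∈ (q : Submodule K M)} K (q : Submodule K M)
        (Dual K (q : Submodule K M)))
    (hQ : ∀ i, (Q.root i : M) = P.root i) (hgood : Good Q)
    (s : Set ι) (hli : LinearIndepOn K P.root s)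
    (hsp : ∀ i, P.root i ∈ AddSubmonoid.closure (P.root '' s) ∨
      -P.root i ∈ AddSubmonoid.closure (P.root '' s))
    (g : M →ₗ[K] K) (hg : ∀ i ∈ s, g (P.root i) = 1) (k : ℕ) (hk : 1 ≤ k) :
    Nat.card {i : {i // P.root i ∈ (q : Submodule K M)} // g (P.root i) = (k : K) + 1} ≤
      Nat.card {i : {i // P.root i ∈ (q : Submodule K M)} // g (P.root i) = (k : K)} := by
  have himg : ∀ x : (q : Submodule K M),
      (x : M) ∈ AddSubmonoid.closure (P.root '' (s ∩ {i | P.root i ∈ (q : Submodule K M)})) →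
      x ∈ AddSubmonoid.closure (Q.root '' {i | i.1 ∈ s}) := by
    intro x hx
    have h1 : P.root '' (s ∩ {i | P.root i ∈ (q : Submodule K M)}) =
        (q : Submodule K M).subtype.toAddMonoidHom '' (Q.root '' {i | i.1 ∈ s}) := by
      ext y
      constructor
      · rintro ⟨i, hi, rfl⟩
        exact ⟨_, ⟨⟨i, hi.2⟩, hi.1, rfl⟩, hQ _⟩
      · rintro ⟨_, ⟨i, hi, rfl⟩, rfl⟩
        exact ⟨i, ⟨hi, i.2⟩, (hQ i).symm⟩
    rw [h1, ← AddMonoidHom.map_mclosure] at hx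
    obtain ⟨y, hy, hyx⟩ := hx
    have : y = x := Subtype.ext hyx
    rwa [← this]
  have := hgood {i | i.1 ∈ s} ?_ ?_ (g ∘ₗ (q : Submodule K M).subtype) ?_ k hk
  · simpa [hQ] using this
  · have h1 : LinearIndepOn K ((q : Submodule K M).subtype ∘ Q.root) {i | i.1 ∈ s} := by
      have h2 : LinearIndepOn K (P.root ∘ Subtype.val)
          {i : {i // P.root i ∈ (q : Submodule K M)} | i.1 ∈ s} := by
        have h3 : LinearIndepOn K P.root (Subtype.val ''
          {i : {i // P.root i ∈ (q : Submodule K M)} | i.1 ∈ s}) := hli.mono (by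
            rintro _ ⟨i, hi, rfl⟩; exact hi)
        exact h3.comp_of_image Subtype.val_injective.injOn
      convert h2 using 1
      ext i; simp [hQ]
    exact h1.of_comp _
  · intro i
    rcases hsp i with h | h
    · left; apply himg; rw [hQ]; exact closure_sub P q s _ i.2 h
    · right; apply himg; rw [Submodule.coe_neg, hQ]
      exact closure_sub P q s _ (Submodule.neg_mem _ i.2) h
  · intro i hi
    simpa [hQ] using hg i hi

end KostantAux

namespace KostantAux
open RootPairing Module

universe u v in
theorem good_aux {K : Type*} [Field K] [CharZero K] (n : ℕ) : ∀ (ι : Type u) [Finite ι]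
    (M : Type v) [AddCommGroup M] [Module K M] [FiniteDimensional K M]
    (P : RootPairing ι K M (Dual K M)) [P.IsCrystallographic] [P.IsReduced] [P.IsRootSystem],
    finrank K M = n → Good P := by
  induction n using Nat.strong_induction_on with
  | _ n ih =>
  intro ι _ M _ _ _ P _ _ _ hn s hli hsp g hg k hk
  classical
  have := Fintype.ofFinite ι
  rcases isEmpty_or_nonempty ι with hι | ⟨⟨i0⟩⟩
  · simp
  have : Nontrivial M := ⟨⟨P.root i0, 0, P.ne_zero i0⟩⟩
  by_cases hirr : P.IsIrreducible
  · let b := Base.mk' P s hli hsp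
    refine irred_case P b g (fun i hi => hg i ?_) k hk
    simpa [b, Base.mk'] using hi
  obtain ⟨q, hqb, hqt⟩ : ∃ q : P.invtRootSubmodule, q ≠ ⊥ ∧ q ≠ ⊤ := by
    by_contra hcon
    push Not at hcon
    apply hirr
    apply IsIrreducible.mk'
    intro q hq hqb
    have := hcon ⟨q, P.mem_invtRootSubmodule_iff.mpr hq⟩ (by
      intro h; exact hqb (congrArg Subtype.val h))
    exact congrArg Subtype.val this
  have horth : ∀ i j, P.root i ∈ (q : Submodule K M) → P.root j ∉ (q : Submodule K M) →
      P.coroot' i (P.root j) = 0 := by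
    intro i j hi hj
    rw [P.root_coroot'_eq_pairing, P.pairing_eq_zero_iff', ← P.root_coroot'_eq_pairing]
    exact LinearMap.mem_ker.mp (invtRootSubmodule.le_ker_coroot' q hj hi)
  let Q2 : Submodule K M := ⨅ i : {i // P.root i ∈ (q : Submodule K M)}, LinearMap.ker (P.coroot' i)
  have hQ2 : ∀ x, x ∈ Q2 ↔ ∀ i, P.root i ∈ (q : Submodule K M) → P.coroot' i x = 0 := by
    intro x; simp [Q2]
  let q2 : P.invtRootSubmodule := ⟨Q2, by
    rw [P.mem_invtRootSubmodule_iff]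
    intro j x hx
    have hx' := (hQ2 x).mp hx
    change P.reflection j x ∈ Q2
    rw [hQ2]
    intro i hi
    rw [P.reflection_apply, map_sub, map_smul, hx' i hi, zero_sub, neg_eq_zero]
    by_cases hj : P.root j ∈ (q : Submodule K M)
    · rw [hx' j hj, zero_smul]
    · rw [horth i j hi hj, smul_zero]⟩
  have hmem : ∀ j, P.root j ∈ (q2 : Submodule K M) ↔ P.root j ∉ (q : Submodule K M) := by
    intro j
    constructor
    · intro h hj
      have := (hQ2 _).mp h j hj
      simp at this
    · intro h
      exact (hQ2 _).mpr fun i hi => horth i j hi h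
  have hf1 : finrank K (q : Submodule K M) < n := by
    rw [← hn]
    apply Submodule.finrank_lt
    intro h; exact hqt (Subtype.ext h)
  have hf2 : finrank K (q2 : Submodule K M) < n := by
    rw [← hn]
    apply Submodule.finrank_lt
    intro h
    apply hqb
    rw [invtRootSubmodule.eq_bot_iff]
    intro i
    rw [← hmem, h]
    trivial
  obtain ⟨R1, hR1, _, _, _⟩ := exists_sub P q
  obtain ⟨R2, hR2, _, _, _⟩ := exists_sub P q2
  have h1 := good_sub P q R1 hR1 (ih _ hf1 _ _ R1 rfl) s hli hsp g hg k hk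
  have h2 := good_sub P q2 R2 hR2 (ih _ hf2 _ _ R2 rfl) s hli hsp g hg k hk
  have hsplit : ∀ p : ι → Prop, Nat.card {i // p i} =
      Nat.card {i : {i // P.root i ∈ (q : Submodule K M)} // p i} +
      Nat.card {i : {i // P.root i ∈ (q2 : Submodule K M)} // p i} := by
    intro p
    rw [← Nat.card_sum]
    refine Nat.card_congr ?_
    refine ((Equiv.sumCompl (fun i : {i // p i} => P.root i ∈ (q : Submodule K M))).symm).trans ?_
    exact Equiv.sumCongr
      ⟨fun i => ⟨⟨i.1.1, i.2⟩, i.1.2⟩, fun i => ⟨⟨i.1.1, i.2⟩, i.1.2⟩, fun _ => rfl, fun _ => rfl⟩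
      ⟨fun i => ⟨⟨i.1.1, (hmem _).mpr i.2⟩, i.1.2⟩, fun i => ⟨⟨i.1.1, i.2⟩, (hmem _).mp i.1.2⟩,
        fun _ => rfl, fun _ => rfl⟩
  rw [hsplit, hsplit]
  omega

theorem good {ι K M N : Type*} [Finite ι] [Field K] [CharZero K]
    [AddCommGroup M] [Module K M] [AddCommGroup N] [Module K N] [FiniteDimensional K M]
    (P : RootPairing ι K M N) [P.IsCrystallographic] [P.IsReduced] [P.IsRootSystem] : Good P := by
  intro s hli hsp g hg k hk
  obtain ⟨R, hR, _, _, _⟩ := exists_sub P ⊤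
  have h1 := good_sub P ⊤ R hR (good_aux _ _ _ R rfl) s hli hsp g hg k hk
  have hsplit : ∀ p : ι → Prop, Nat.card {i // p i} =
      Nat.card {i : {i // P.root i ∈ ((⊤ : P.invtRootSubmodule) : Submodule K M)} // p i} := by
    intro p
    refine Nat.card_congr ?_
    refine (Equiv.subtypeEquiv (Equiv.subtypeUnivEquiv (by simp)) (by simp)).symm
  rw [hsplit, hsplit]
  exact h1
end KostantAux

namespace KostantAux
open RootPairing Module

theorem isPos_reflect {ι K M N : Type*} [Finite ι] [Field K] [CharZero K]
    [AddCommGroup M] [Module K M] [AddCommGroup N] [Module K N]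
    {P : RootPairing ι K M N} [P.IsCrystallographic] [P.IsReduced] (b : P.Base) {i j : ι}
    (hj : j ∈ b.support) (hij : i ≠ j) (hij' : P.reflectionPerm j i ≠ j) :
    b.IsPos (P.reflectionPerm j i) ↔ b.IsPos i := by
  refine ⟨fun h => ?_, fun h => h.reflectionPerm hj hij⟩
  simpa using h.reflectionPerm hj hij'

theorem isPos_neg {ι K M N : Type*} [Field K] [CharZero K]
    [AddCommGroup M] [Module K M] [AddCommGroup N] [Module K N]
    {P : RootPairing ι K M N} (b : P.Base) (i : ι) :
    b.IsPos (P.reflectionPerm i i) ↔ ¬ b.IsPos i := Base.IsPos.neg_iff_not b i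

theorem isPos_flip {ι K M N : Type*} [Finite ι] [Field K] [CharZero K]
    [AddCommGroup M] [Module K M] [AddCommGroup N] [Module K N]
    {P : RootPairing ι K M N} [P.IsCrystallographic] [P.IsReduced] (b : P.Base) (i : ι) :
    b.IsPos i ↔ b.flip.IsPos i := by
  have hneg : ∀ i, b.flip.IsPos (P.reflectionPerm i i) ↔ ¬ b.flip.IsPos i :=
    fun i => isPos_neg b.flip i
  induction i using b.induction_reflect with
  | h₀ i hi => rw [isPos_neg, hneg]; exact not_congr hi
  | h₁ i hi =>
    exact iff_of_true (Base.isPos_of_mem_support hi) (Base.isPos_of_mem_support (b := b.flip) hi)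
  | h₂ i j hi hj =>
    by_cases hij : i = j
    · subst hij
      rw [isPos_neg, hneg]; exact not_congr hi
    by_cases hij' : P.reflectionPerm j i = j
    · rw [hij']
      exact iff_of_true (Base.isPos_of_mem_support hj) (Base.isPos_of_mem_support (b := b.flip) hj)
    rw [isPos_reflect b hj hij hij']
    refine Iff.trans hi ?_
    exact (isPos_reflect b.flip (P := P.flip) hj hij hij').symm

theorem isPos_iff_nat {ι K M N : Type*} [Field K] [CharZero K]
    [AddCommGroup M] [Module K M] [AddCommGroup N] [Module K N]
    {P : RootPairing ι K M N} (b : P.Base) (i : ι) :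
    b.IsPos i ↔ ∃ c : ι → ℕ, P.root i = ∑ j ∈ b.support, (c j : K) • P.root j := by
  constructor
  · intro h
    obtain ⟨f, -, hf | hf⟩ := b.exists_root_eq_sum_nat_or_neg i
    · exact ⟨f, by simpa [Nat.cast_smul_eq_nsmul] using hf⟩
    · exfalso
      have := Base.height_eq_sum (b := b) (i := i) (f := fun j => -(f j : ℤ))
        (by simpa using hf)
      rw [Base.isPos_iff, this] at h
      have h2 : 0 ≤ ∑ j ∈ b.support, (f j : ℤ) := by positivity
      rw [Finset.sum_neg_distrib] at h
      omega
  · rintro ⟨c, hc⟩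
    have := Base.height_eq_sum (b := b) (i := i) (f := fun j => (c j : ℤ))
        (by simpa [Nat.cast_smul_eq_nsmul] using hc)
    rw [Base.isPos_iff', this]
    positivity

theorem height_eq_eval {ι K M N : Type*} [Field K] [CharZero K]
    [AddCommGroup M] [Module K M] [AddCommGroup N] [Module K N]
    {P : RootPairing ι K M N} (b : P.Base) (g : M →ₗ[K] K)
    (hg : ∀ i ∈ b.support, g (P.root i) = 1) (i : ι) :
    g (P.root i) = (b.height i : K) := by
  obtain ⟨f, -, -, hf⟩ := b.exists_root_eq_sum_int i
  rw [Base.height_eq_sum hf, hf, map_sum, Int.cast_sum]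
  refine Finset.sum_congr rfl fun j hj => ?_
  rw [map_zsmul, hg j hj, zsmul_one]

theorem mem_support_of_height {ι K M N : Type*} [Field K] [CharZero K]
    [AddCommGroup M] [Module K M] [AddCommGroup N] [Module K N]
    {P : RootPairing ι K M N} (b : P.Base) (i : ι) (h : b.height i = 1) : i ∈ b.support := by
  classical
  obtain ⟨c, hc⟩ := (isPos_iff_nat b i).mp (by rw [Base.isPos_iff, h]; norm_num)
  have h1 := Base.height_eq_sum (b := b) (i := i) (f := fun j => (c j : ℤ))
        (by simpa [Nat.cast_smul_eq_nsmul] using hc)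
  rw [h] at h1
  have h2 : ∑ j ∈ b.support, c j = 1 := by exact_mod_cast h1.symm
  obtain ⟨j, hj, hcj⟩ : ∃ j ∈ b.support, c j ≠ 0 := by
    by_contra! hcon
    rw [Finset.sum_eq_zero hcon] at h2
    omega
  rw [← Finset.add_sum_erase _ _ hj] at h2
  have h3 : ∑ x ∈ b.support.erase j, c x = 0 := by omega
  have h4 : c j = 1 := by omega
  rw [Finset.sum_eq_zero_iff] at h3
  have : P.root i = P.root j := by
    rw [hc, ← Finset.add_sum_erase _ _ hj, h4, Finset.sum_eq_zero]
    · simp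
    · intro x hx; rw [h3 x hx]; simp
  rwa [P.root.injective this]

theorem sum_pairing {ι K M N : Type*} [Finite ι] [Field K] [CharZero K]
    [AddCommGroup M] [Module K M] [AddCommGroup N] [Module K N]
    {P : RootPairing ι K M N} [P.IsCrystallographic] [P.IsReduced] (b : P.Base)
    (pos : Finset ι) (hpos : ∀ i, i ∈ pos ↔ b.IsPos i) (i : ι) (hi : i ∈ b.support) :
    ∑ γ ∈ pos, P.pairing γ i = 2 := by
  classical
  have hip : i ∈ pos := (hpos i).mpr (Base.isPos_of_mem_support hi)
  rw [← Finset.add_sum_erase _ _ hip, P.pairing_same]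
  have hni : ∀ γ ∈ pos, P.reflectionPerm i γ ≠ i := by
    intro γ hγ h
    have h2 : γ = P.reflectionPerm i i := by
      have h3 := congrArg (P.reflectionPerm i) h
      rwa [P.reflectionPerm_self] at h3
    rw [hpos, h2, isPos_neg] at hγ
    exact hγ (Base.isPos_of_mem_support hi)
  have hmem : ∀ γ ∈ pos.erase i, P.reflectionPerm i γ ∈ pos.erase i := by
    intro γ hγ
    rw [Finset.mem_erase] at hγ ⊢
    refine ⟨hni γ hγ.2, ?_⟩
    rw [hpos] at hγ ⊢
    exact hγ.2.reflectionPerm hi hγ.1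
  have hS : ∑ γ ∈ pos.erase i, P.pairing γ i = ∑ γ ∈ pos.erase i, -P.pairing γ i := by
    refine Finset.sum_nbij' (fun γ => P.reflectionPerm i γ) (fun γ => P.reflectionPerm i γ)
      hmem hmem (by simp) (by simp) ?_
    intro γ _
    rw [← P.pairing_reflectionPerm, P.pairing_reflectionPerm_self_right, neg_neg]
  rw [Finset.sum_neg_distrib, self_eq_neg] at hS
  rw [hS, add_zero]

theorem count_identity {ι K M N : Type*} [Fintype ι] [DecidableEq ι] [Field K] [CharZero K]
    [AddCommGroup M] [Module K M] [FiniteDimensional K M]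
    [AddCommGroup N] [Module K N]
    (P : RootPairing ι K M N) [P.IsCrystallographic] [P.IsReduced] [P.IsRootSystem]
    (b : P.Base) (pos : Finset ι) (hpos : ∀ i, i ∈ pos ↔ b.IsPos i)
    (ht : ι → ℤ) (hht : ∀ α ∈ pos, ((2 * ht α : ℤ) : K) = ∑ γ ∈ pos, P.pairing γ α) :
    ∃ a : Multiset ℤ, a.card = b.support.card ∧ (∀ x ∈ a, 2 ≤ x) ∧
      Multiset.map (fun α => ht α + 1) pos.val = Multiset.map ht (pos \ b.support).val + a := by
  have : FiniteDimensional K N := Module.Finite.equiv P.flip.toPerfPair.symm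
  let g : N →ₗ[K] K := (2 : K)⁻¹ • ∑ γ ∈ pos, P.root' γ
  have hgv : ∀ α, g (P.coroot α) = (2 : K)⁻¹ * ∑ γ ∈ pos, P.pairing γ α := by
    intro α
    simp [g, LinearMap.sum_apply]
  have hg1 : ∀ i ∈ b.flip.support, g (P.flip.root i) = 1 := by
    intro i hi
    have : g (P.coroot i) = 1 := by
      rw [hgv, sum_pairing b pos hpos i hi]; norm_num
    exact this
  have hgh : ∀ i, g (P.coroot i) = (b.flip.height i : K) := fun i =>
    height_eq_eval b.flip g hg1 i
  have hth : ∀ α ∈ pos, ht α = b.flip.height α := by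
    intro α hα
    have h1 := hgh α
    rw [hgv, ← hht α hα] at h1
    have h2 : ((ht α : ℤ) : K) = (b.flip.height α : K) := by
      rw [← h1]; push_cast; field_simp
    exact_mod_cast h2
  have hposf : ∀ i, i ∈ pos ↔ 0 < b.flip.height i := by
    intro i
    rw [hpos, isPos_flip, Base.isPos_iff]
  have hsub : b.support ⊆ pos := fun i hi => (hpos i).mpr (Base.isPos_of_mem_support hi)
  have hcount : ∀ k : ℕ, 1 ≤ k →
      (pos.filter (fun α => ht α = (k : ℤ) + 1)).card ≤ (pos.filter (fun α => ht α = k)).card := by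
    intro k hk
    have h1 := good P.flip b.flip.support b.flip.linearIndepOn_root b.flip.root_mem_or_neg_mem
      g hg1 k hk
    have key : ∀ m : ℤ, 0 < m → ∀ i, (g (P.flip.root i) = (m : K) ↔
        i ∈ pos.filter (fun α => ht α = m)) := by
      intro m hm i
      change g (P.coroot i) = _ ↔ _
      rw [hgh, Finset.mem_filter, Int.cast_inj]
      constructor
      · intro h
        have hi : i ∈ pos := by rw [hposf, h]; exact hm
        exact ⟨hi, by rw [hth i hi, h]⟩
      · rintro ⟨hi, h⟩
        rw [← hth i hi, h]
    have e1 : Nat.card {i // g (P.flip.root i) = (k : K) + 1} =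
        (pos.filter (fun α => ht α = (k : ℤ) + 1)).card := by
      have := key ((k : ℤ) + 1) (by omega)
      push_cast at this
      rw [← Nat.card_eq_finsetCard]
      exact Nat.card_congr (Equiv.subtypeEquivRight this)
    have e2 : Nat.card {i // g (P.flip.root i) = (k : K)} =
        (pos.filter (fun α => ht α = (k : ℤ))).card := by
      have := key (k : ℤ) (by omega)
      push_cast at this
      rw [← Nat.card_eq_finsetCard]
      exact Nat.card_congr (Equiv.subtypeEquivRight this)
    rw [e1, e2] at h1
    exact h1
  have hle : Multiset.map ht (pos \ b.support).val ≤ Multiset.map (fun α => ht α + 1) pos.val := by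
    rw [Multiset.le_iff_count]
    intro m
    rw [Multiset.count_map, Multiset.count_map]
    change ((pos \ b.support).filter (fun α => m = ht α)).card ≤
      (pos.filter (fun α => m = ht α + 1)).card
    by_cases hm : 2 ≤ m
    · obtain ⟨k, hk⟩ := Int.eq_ofNat_of_zero_le (by omega : 0 ≤ m - 1)
      have := hcount k (by omega)
      calc _ ≤ (pos.filter (fun α => ht α = (k : ℤ) + 1)).card := by
            apply Finset.card_le_card
            intro x hx
            rw [Finset.mem_filter, Finset.mem_sdiff] at hx
            rw [Finset.mem_filter]
            exact ⟨hx.1.1, by omega⟩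
        _ ≤ _ := this
        _ = _ := by
            congr 1
            apply Finset.filter_congr
            intro x _
            constructor <;> intro h <;> omega
    · have : (pos \ b.support).filter (fun α => m = ht α) = ∅ := by
        rw [Finset.filter_eq_empty_iff]
        intro x hx hmx
        rw [Finset.mem_sdiff] at hx
        have h1 := (hposf x).mp hx.1
        have h2 := hth x hx.1
        exact hx.2 (mem_support_of_height b.flip x (by omega))
      rw [this]
      simp
  obtain ⟨a, ha⟩ := Multiset.le_iff_exists_add.mp hle
  refine ⟨a, ?_, ?_, ha⟩
  · have h1 := congrArg Multiset.card ha
    rw [Multiset.card_add, Multiset.card_map, Multiset.card_map, Finset.card_val, Finset.card_val,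
      Finset.card_sdiff_of_subset hsub] at h1
    have := Finset.card_le_card hsub
    omega
  · intro x hx
    have h1 : x ∈ Multiset.map (fun α => ht α + 1) pos.val := by
      rw [ha]; exact Multiset.mem_add.mpr (Or.inr hx)
    obtain ⟨α, hα, rfl⟩ := Multiset.mem_map.mp h1
    have h2 := (hposf α).mp hα
    have h3 := hth α hα
    omega

end KostantAux

/-- (Kostant)  Let `P` be a finite reduced crystallographic root pairing whose roots span the
ambient space (a root system), with base `Δ` and set `pos` of positive roots, and let
`ht α = ⟨ρ, α^∨⟩` (so that `2 * ht α = ∑_{γ ∈ Φ⁺} ⟨γ, α^∨⟩`, i.e. `ht α` is the height of the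
coroot `α^∨`).  Then there is a multiset `a` of integers, of cardinality `n = |Δ|`, all of
whose members are `≥ 2`, such that the multiset `{⟨ρ, α^∨⟩ + 1 : α ∈ Φ⁺}` equals the multiset
`{⟨ρ, α^∨⟩ : α ∈ Φ⁺ \ Δ}` plus `a`. -/
theorem kostant_height_multiset_identity
    {ι K M N : Type*} [Fintype ι] [DecidableEq ι] [Field K] [CharZero K]
    [AddCommGroup M] [Module K M] [FiniteDimensional K M]
    [AddCommGroup N] [Module K N]
    (P : RootPairing ι K M N)
    (hspan : Submodule.span K (Set.range P.root) = ⊤)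
    (hcrys : P.IsCrystallographic) (hred : P.IsReduced)
    (Δ pos : Finset ι)
    (hli : LinearIndependent K (fun j : ↥(↑Δ : Set ι) => P.root j.1))
    (hdecomp : ∀ i : ι, (∃ c : ι → ℕ, P.root i = ∑ j ∈ Δ, (c j : K) • P.root j) ∨
      (∃ c : ι → ℕ, P.root i = -∑ j ∈ Δ, (c j : K) • P.root j))
    (hpos : ∀ i : ι, i ∈ pos ↔ ∃ c : ι → ℕ, P.root i = ∑ j ∈ Δ, (c j : K) • P.root j)
    (ht : ι → ℤ)
    (hht : ∀ α ∈ pos, ((2 * ht α : ℤ) : K) = ∑ γ ∈ pos, P.pairing γ α) :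
    ∃ a : Multiset ℤ, Multiset.card a = Δ.card ∧ (∀ x ∈ a, 2 ≤ x) ∧
      Multiset.map (fun α => ht α + 1) pos.val =
        Multiset.map ht (pos \ Δ).val + a := by
  have hrs : P.IsRootSystem := ⟨hspan, (P.rootSpan_eq_top_iff).mp hspan⟩
  have hcl : ∀ c : ι → ℕ, ∑ j ∈ Δ, (c j : K) • P.root j ∈
      AddSubmonoid.closure (P.root '' (Δ : Set ι)) := by
    intro c
    refine AddSubmonoid.sum_mem _ fun j hj => ?_
    rw [Nat.cast_smul_eq_nsmul]
    exact AddSubmonoid.nsmul_mem _ (AddSubmonoid.subset_closure (Set.mem_image_of_mem _ hj)) _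
  let b := RootPairing.Base.mk' P (Δ : Set ι) hli (by
    intro i
    rcases hdecomp i with ⟨c, hc⟩ | ⟨c, hc⟩
    · left; rw [hc]; exact hcl c
    · right; rw [hc, neg_neg]; exact hcl c)
  have hb : b.support = Δ := by simp [b, RootPairing.Base.mk']
  have hpos' : ∀ i, i ∈ pos ↔ b.IsPos i := by
    intro i
    rw [hpos, KostantAux.isPos_iff_nat, hb]
  have := KostantAux.count_identity P b pos hpos' ht hht
  rwa [hb] at this
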